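/- arXiv:1603.01018 — 2 statements merged into one kernel-verified Lean document; each statement's English description precedes it below -/
import Mathlib

section
/- Let m = ⌊N/3⌋ and let 𝒮 be a finite set with 1 ≤ log₂|𝒮| ≤ m^{1/4}. For every sufficiently large N and every integer k with 2 ≤ k ≤ log m, one has r_k(m,𝒮) ≥ 0.99·√(2m·(log C(m+1, k-1) + k·log|𝒮|)). -/
/-- `P(S(m,1/2) ≥ x)` for a binomial random variable `S(m,1/2)` with parameters
`m` and `1/2`, i.e. `P(S(m,1/2) = j) = C(m,j)/2^m` for `0 ≤ j ≤ m`. -/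
noncomputable def binomialUpperTail (m : ℕ) (x : ℝ) : ℝ :=
  (∑ j ∈ Finset.range (m + 1), if x ≤ (j : ℝ) then (m.choose j : ℝ) else 0) / 2 ^ m

/-- For `m = ⌊N/3⌋` and a seed set of size `s` (small seed sets), `r_k(m,𝒮)` is the
maximal `r ∈ ℕ` with `P(S(m,1/2) ≥ (m+r)/2) ≥ k² log N / (C(m+1,k-1)·s^k)`. -/
noncomputable def rkSmall (N k s : ℕ) : ℕ :=
  sSup {r : ℕ |
    ((k : ℝ) ^ 2 * Real.log N) / (((N / 3 + 1).choose (k - 1) : ℝ) * (s : ℝ) ^ k) ≤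
      binomialUpperTail (N / 3) ((((N / 3 : ℕ) : ℝ) + (r : ℝ)) / 2)}

open Filter in
/-- Growth conditions on `m` under which the tail estimate is applied. -/
theorem eventually_growth_conditions :
    ∀ᶠ m : ℕ in atTop,
      2 * (Real.log m ^ 2 * Real.log (3 * m + 3)) ≤ (m : ℝ) ^ (0.01 : ℝ) ∧
      Real.log m * Real.log (m + 1) + Real.log m * (m : ℝ) ^ ((1 : ℝ) / 4) ≤ m / 10 ^ 8 ∧
      (10 : ℝ) ^ 8 ≤ Real.log m ∧ (10 : ℝ) ^ 8 ≤ m := by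
  have hlog : Tendsto Real.log atTop atTop := Real.tendsto_log_atTop
  have hb : ∀ᶠ x : ℝ in atTop, (10 : ℝ) ^ 8 ≤ Real.log x := hlog.eventually_ge_atTop _
  have hx : ∀ᶠ x : ℝ in atTop, (10 : ℝ) ^ 8 ≤ x := eventually_ge_atTop _
  have h1 := (isLittleO_log_rpow_atTop (r := 0.003) (by norm_num)).bound
    (show (0 : ℝ) < 1 / 2 by norm_num)
  have h2 := (isLittleO_log_rpow_atTop (r := (1 : ℝ) / 4) (by norm_num)).bound
    (show (0 : ℝ) < 1 / 10 ^ 9 by norm_num)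
  have key : ∀ᶠ x : ℝ in atTop,
      2 * (Real.log x ^ 2 * Real.log (3 * x + 3)) ≤ x ^ (0.01 : ℝ) ∧
      Real.log x * Real.log (x + 1) + Real.log x * x ^ ((1 : ℝ) / 4) ≤ x / 10 ^ 8 ∧
      (10 : ℝ) ^ 8 ≤ Real.log x ∧ (10 : ℝ) ^ 8 ≤ x := by
    filter_upwards [hb, hx, h1, h2] with x hb hx h1 h2
    have hx0 : 0 < x := by linarith
    rw [Real.norm_of_nonneg (by linarith), Real.norm_of_nonneg (by positivity)] at h1 h2
    have hl3 : Real.log (3 * x + 3) ≤ 2 * Real.log x := by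
      rw [show 2 * Real.log x = Real.log (x ^ 2) by rw [Real.log_pow]; norm_num]
      exact Real.log_le_log (by linarith) (by nlinarith)
    have hl1 : Real.log (x + 1) ≤ 2 * Real.log x :=
      (Real.log_le_log (by linarith) (by linarith)).trans hl3
    refine ⟨?_, ?_, hb, hx⟩
    · have e : x ^ (0.01 : ℝ) = (x ^ (0.003 : ℝ)) ^ 3 * x ^ (0.001 : ℝ) := by
        rw [← Real.rpow_natCast (x ^ (0.003 : ℝ)), ← Real.rpow_mul hx0.le, ← Real.rpow_add hx0]
        norm_num
      have e1 : 1 ≤ x ^ (0.001 : ℝ) := Real.one_le_rpow (by linarith) (by norm_num)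
      have e2 : (2 * Real.log x) ^ 3 ≤ (x ^ (0.003 : ℝ)) ^ 3 := by
        gcongr
        linarith
      rw [e]
      calc 2 * (Real.log x ^ 2 * Real.log (3 * x + 3))
          ≤ 2 * (Real.log x ^ 2 * (2 * Real.log x)) := by gcongr
        _ ≤ (2 * Real.log x) ^ 3 := by
          have : 0 ≤ Real.log x ^ 3 := pow_nonneg (by linarith) 3
          nlinarith
        _ ≤ (x ^ (0.003 : ℝ)) ^ 3 := e2
        _ ≤ _ := le_mul_of_one_le_right (by positivity) e1
    · set q := x ^ ((1 : ℝ) / 4)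
      have e : x = q ^ 4 := by
        rw [← Real.rpow_natCast q, ← Real.rpow_mul hx0.le]
        norm_num
      have hq1 : 1 ≤ q := Real.one_le_rpow (by linarith) (by norm_num)
      have hq2 : q ^ 2 ≤ q ^ 4 := pow_le_pow_right₀ hq1 (by norm_num)
      have hL0 : 0 ≤ Real.log x := by linarith
      have a1 : Real.log x * Real.log (x + 1) ≤ (1 / 10 ^ 9 * q) * (2 * (1 / 10 ^ 9 * q)) := by
        apply mul_le_mul h2 (by linarith) (Real.log_nonneg (by linarith)) (by positivity)
      have a2 : Real.log x * q ≤ (1 / 10 ^ 9 * q) * q := by gcongr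
      have : Real.log x * Real.log (x + 1) + Real.log x * q ≤ q ^ 4 / 10 ^ 8 := by nlinarith
      rwa [← e] at this
  exact tendsto_natCast_atTop_atTop.eventually key

theorem sixteen_pow_le_mul_centralBinom_sq (n : ℕ) :
    16 ^ (n + 1) ≤ 4 * (n + 1) * (n + 1).centralBinom ^ 2 := by
  induction n with
  | zero => decide
  | succ n ih =>
    have h := Nat.succ_mul_centralBinom_succ (n + 1)
    set c := (n + 1).centralBinom
    set d := (n + 1 + 1).centralBinom
    have hd : (n + 2) * (4 * (n + 2) * d ^ 2) = 4 * (2 * (2 * (n + 1) + 1) * c) ^ 2 := by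
      rw [← h]; ring
    have : (n + 2) * 16 ^ (n + 2) ≤ (n + 2) * (4 * (n + 2) * d ^ 2) := by
      rw [hd, pow_succ]
      calc (n + 2) * (16 ^ (n + 1) * 16) ≤ (n + 2) * ((4 * (n + 1) * c ^ 2) * 16) := by gcongr
        _ ≤ _ := by nlinarith [Nat.zero_le (c ^ 2)]
    exact Nat.le_of_mul_le_mul_left this (by omega)

theorem two_pow_sq_le_mul_choose_half_sq (m : ℕ) :
    (2 ^ m) ^ 2 ≤ 4 * (m / 2 + 1) * (m.choose (m / 2)) ^ 2 := by
  obtain ⟨h, rfl | rfl⟩ := Nat.even_or_odd' m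
  · rw [Nat.mul_div_cancel_left h two_pos]
    have e : (2 ^ (2 * h)) ^ 2 = 16 ^ h := by
      rw [← pow_mul, mul_assoc, mul_comm h, ← mul_assoc, pow_mul]
      norm_num
    rw [e, ← Nat.centralBinom_eq_two_mul_choose]
    cases h with
    | zero => simp
    | succ n =>
      refine (sixteen_pow_le_mul_centralBinom_sq n).trans ?_
      gcongr
      omega
  · have e0 : (2 * h + 1) / 2 = h := by omega
    have hc : (h + 1).centralBinom = 2 * (2 * h + 1).choose h := by
      rw [Nat.centralBinom_eq_two_mul_choose, show 2 * (h + 1) = 2 * h + 1 + 1 by ring,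
        Nat.choose_succ_succ, Nat.choose_symm_half]
      ring
    have := sixteen_pow_le_mul_centralBinom_sq h
    rw [hc] at this
    rw [e0]
    have e : (2 ^ (2 * h + 1)) ^ 2 * 4 = 16 ^ (h + 1) := by
      rw [show (16 : ℕ) = 2 ^ 4 by norm_num, ← pow_mul, ← pow_mul, show 4 = 2 ^ 2 by norm_num,
        ← pow_add]
      congr 1
      ring
    nlinarith

theorem two_pow_le_sqrt_mul_choose_half (m : ℕ) :
    (2 : ℝ) ^ m ≤ 2 * √((m / 2 : ℕ) + 1) * m.choose (m / 2) := by
  refine le_of_pow_le_pow_left₀ two_ne_zero (by positivity) ?_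
  rw [mul_pow, mul_pow, Real.sq_sqrt (by positivity)]
  have := two_pow_sq_le_mul_choose_half_sq m
  have h : (((2 ^ m) ^ 2 : ℕ) : ℝ) ≤ ((4 * (m / 2 + 1) * (m.choose (m / 2)) ^ 2 : ℕ) : ℝ) :=
    Nat.cast_le.mpr this
  push_cast at h ⊢
  linarith

theorem choose_half_mul_exp_le_choose (m a : ℕ) (ha : a < m / 2) (i : ℕ) (hi : i ≤ a) :
    (m.choose (m / 2) : ℝ) * Real.exp (-((i : ℝ) ^ 2 / ((m / 2 : ℕ) - a : ℝ))) ≤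
      m.choose (m / 2 + i) := by
  induction i with
  | zero => simp
  | succ i ih =>
    set h := m / 2 with hh
    have hpos : (0 : ℝ) < (h : ℝ) - a := by
      have : (a : ℝ) < h := by exact_mod_cast ha
      linarith
    have hia : (i : ℝ) ≤ a := by exact_mod_cast (Nat.le_of_succ_le hi)
    have hpos' : (0 : ℝ) < (h : ℝ) - i := by linarith
    have hrec : (m.choose (h + (i + 1)) : ℝ) * (h + i + 1) = m.choose (h + i) * (m - (h + i)) := by
      have := Nat.choose_succ_right_eq m (h + i)
      have h' : ((m.choose (h + i + 1) * (h + i + 1) : ℕ) : ℝ) =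
        ((m.choose (h + i) * (m - (h + i)) : ℕ) : ℝ) := by rw [this]
      rw [Nat.cast_mul, Nat.cast_mul, Nat.cast_sub (by omega)] at h'
      push_cast at h'
      exact h'
    have hm : (h : ℝ) * 2 ≤ m := by exact_mod_cast Nat.div_mul_le_self m 2
    have hexp : ((h : ℝ) + i + 1) * Real.exp (-((2 * i + 1) / (h - a))) ≤ h - i := by
      rw [Real.exp_neg, ← div_eq_mul_inv, div_le_iff₀ (Real.exp_pos _)]
      have h1 : ((2 * i + 1) / (h - i) : ℝ) + 1 ≤ Real.exp ((2 * i + 1) / (h - a)) := by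
        refine le_trans ?_ (Real.add_one_le_exp _)
        gcongr
      calc (h : ℝ) + i + 1 = (h - i) * ((2 * i + 1) / (h - i) + 1) := by field_simp; ring
        _ ≤ _ := by gcongr
    have e : Real.exp (-(((i + 1 : ℕ) : ℝ) ^ 2 / (h - a))) =
        Real.exp (-((i : ℝ) ^ 2 / (h - a))) * Real.exp (-((2 * i + 1) / (h - a))) := by
      rw [← Real.exp_add]
      congr 1
      push_cast
      field_simp
      ring
    have hp : (0 : ℝ) < h + i + 1 := by positivity
    refine le_of_mul_le_mul_right ?_ hp
    rw [hrec, e]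
    calc (m.choose h : ℝ) * (Real.exp (-((i : ℝ) ^ 2 / (h - a))) *
          Real.exp (-((2 * i + 1) / (h - a)))) * (h + i + 1)
        = (m.choose h * Real.exp (-((i : ℝ) ^ 2 / (h - a)))) *
          ((h + i + 1) * Real.exp (-((2 * i + 1) / (h - a)))) := by ring
      _ ≤ m.choose (h + i) * (h - i) := by
          apply mul_le_mul (ih (by omega)) hexp (by positivity) (by positivity)
      _ ≤ _ := mul_le_mul_of_nonneg_left (by linarith) (by positivity)

theorem half_exp_le_binomialUpperTail (m b : ℕ) (x : ℝ) (hx : x ≤ (m / 2 : ℕ) + b)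
    (hb : b + (m / 2).sqrt + 1 < m / 2) :
    1 / 2 * Real.exp (-(((b + (m / 2).sqrt + 1 : ℕ) : ℝ) ^ 2 /
      ((m / 2 : ℕ) - (b + (m / 2).sqrt + 1 : ℕ)))) ≤ binomialUpperTail m x := by
  set h := m / 2 with hh
  set a := b + h.sqrt + 1 with haa
  have hpos : (0 : ℝ) < (h : ℝ) - a := by
    have : (a : ℝ) < h := by exact_mod_cast hb
    linarith
  set E := Real.exp (-((a : ℝ) ^ 2 / (h - a))) with hE
  unfold binomialUpperTail
  rw [le_div_iff₀ (by positivity)]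
  have hsub : Finset.Ico (h + b) (h + a) ⊆ Finset.range (m + 1) := by
    intro j hj
    simp only [Finset.mem_Ico, Finset.mem_range] at *
    omega
  have hsum : ((h.sqrt + 1 : ℕ) : ℝ) * (m.choose h * E) ≤
      ∑ j ∈ Finset.range (m + 1), if x ≤ (j : ℝ) then (m.choose j : ℝ) else 0 := by
    calc ((h.sqrt + 1 : ℕ) : ℝ) * (m.choose h * E)
        = ∑ _j ∈ Finset.Ico (h + b) (h + a), (m.choose h * E) := by
          rw [Finset.sum_const, Nat.card_Ico, nsmul_eq_mul]
          congr 2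
          omega
      _ ≤ ∑ j ∈ Finset.Ico (h + b) (h + a), if x ≤ (j : ℝ) then (m.choose j : ℝ) else 0 := by
          apply Finset.sum_le_sum
          intro j hj
          rw [Finset.mem_Ico] at hj
          obtain ⟨i, rfl⟩ := Nat.exists_eq_add_of_le (show h ≤ j by omega)
          have hbi : (b : ℝ) ≤ i := by exact_mod_cast (show b ≤ i by omega)
          have hia : (i : ℝ) ≤ a := by exact_mod_cast (show i ≤ a by omega)
          rw [if_pos (by push_cast; linarith)]
          refine le_trans ?_ (choose_half_mul_exp_le_choose m a hb i (by omega))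
          rw [hE]
          gcongr
      _ ≤ _ := by
          apply Finset.sum_le_sum_of_subset_of_nonneg hsub
          intro j _ _
          split_ifs <;> positivity
  refine le_trans ?_ hsum
  have hs : √((h : ℝ) + 1) ≤ ((h.sqrt + 1 : ℕ) : ℝ) := by
    rw [Real.sqrt_le_left (by positivity)]
    have := Nat.lt_succ_sqrt h
    exact_mod_cast (show h + 1 ≤ (h.sqrt + 1) ^ 2 by rw [pow_two]; exact this)
  have hE0 : 0 < E := Real.exp_pos _
  have h2 := two_pow_le_sqrt_mul_choose_half m
  rw [← hh] at h2
  calc 1 / 2 * E * 2 ^ m ≤ 1 / 2 * E * (2 * √((h : ℝ) + 1) * m.choose h) := by gcongr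
    _ = √((h : ℝ) + 1) * (m.choose h * E) := by ring
    _ ≤ _ := by gcongr

/-- A Gaussian-type lower bound for the tail at distance `0.99 √(2mL)` from the mean. -/
theorem half_exp_le_binomialUpperTail_ceil (m : ℕ) (L : ℝ) (hm : (10 : ℝ) ^ 8 ≤ m)
    (hL : (10 : ℝ) ^ 8 ≤ L) (hLm : L ≤ m / 10 ^ 8) :
    1 / 2 * Real.exp (-(0.99 * L)) ≤
      binomialUpperTail m (((m : ℝ) + (⌈0.99 * √(2 * m * L)⌉₊ : ℕ)) / 2) := by
  set r := ⌈0.99 * √(2 * m * L)⌉₊ with hr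
  set R := √(2 * m * L) / 2 with hR
  have hm0 : (0 : ℝ) < m := by linarith
  have hL0 : (0 : ℝ) < L := by linarith
  have hR0 : 0 ≤ R := by positivity
  have hR2 : R ^ 2 = m * L / 2 := by
    rw [hR, div_pow, Real.sq_sqrt (by positivity)]
    ring
  have hRm : R ≤ m / 10 ^ 4 := by
    refine le_of_pow_le_pow_left₀ two_ne_zero (by positivity) ?_
    rw [hR2, div_pow]
    nlinarith
  have hrle : (r : ℝ) ≤ 2 * (0.99 * R) + 1 := by
    have := (Nat.ceil_lt_add_one (show 0 ≤ 0.99 * √(2 * m * L) by positivity)).le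
    rw [← hr] at this
    linarith
  set b := r / 2 + 1 with hb
  have hb1 : (r : ℝ) + 1 ≤ 2 * b := by exact_mod_cast (show r + 1 ≤ 2 * b by omega)
  have hb2 : 2 * (b : ℝ) ≤ r + 2 := by exact_mod_cast (show 2 * b ≤ r + 2 by omega)
  have hh1 : (m : ℝ) ≤ 2 * (m / 2 : ℕ) + 1 := by exact_mod_cast (show m ≤ 2 * (m / 2) + 1 by omega)
  have hh2 : 2 * ((m / 2 : ℕ) : ℝ) ≤ m := by exact_mod_cast (show 2 * (m / 2) ≤ m by omega)
  have hs : (((m / 2).sqrt : ℕ) : ℝ) ≤ R / 5000 := by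
    refine le_of_pow_le_pow_left₀ two_ne_zero (by positivity) ?_
    have : (((m / 2).sqrt : ℕ) : ℝ) ^ 2 ≤ (m / 2 : ℕ) := by exact_mod_cast Nat.sqrt_le' (m / 2)
    rw [div_pow, hR2]
    nlinarith
  have hR5 : 5000 ≤ R := by
    refine le_of_pow_le_pow_left₀ two_ne_zero hR0 ?_
    rw [hR2]
    nlinarith
  have ha : ((b + (m / 2).sqrt + 1 : ℕ) : ℝ) ≤ 0.991 * R := by
    push_cast
    linarith
  have hden : 0.999 * ((m : ℝ) / 2) ≤ (m / 2 : ℕ) - ((b + (m / 2).sqrt + 1 : ℕ) : ℝ) := by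
    linarith
  have hlt : b + (m / 2).sqrt + 1 < m / 2 := by
    have : ((b + (m / 2).sqrt + 1 : ℕ) : ℝ) < (m / 2 : ℕ) := by linarith
    exact_mod_cast this
  refine le_trans ?_ (half_exp_le_binomialUpperTail m b _ (by linarith) hlt)
  have hpos : 0 < ((m / 2 : ℕ) : ℝ) - ((b + (m / 2).sqrt + 1 : ℕ) : ℝ) := by linarith
  gcongr
  rw [div_le_iff₀ hpos]
  calc ((b + (m / 2).sqrt + 1 : ℕ) : ℝ) ^ 2 ≤ (0.991 * R) ^ 2 := by gcongr
    _ ≤ 0.99 * L * (0.999 * ((m : ℝ) / 2)) := by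
      rw [mul_pow, hR2]
      nlinarith [mul_pos hm0 hL0]
    _ ≤ _ := by gcongr

theorem binomialUpperTail_eq_zero (m : ℕ) (x : ℝ) (hx : (m : ℝ) < x) :
    binomialUpperTail m x = 0 := by
  unfold binomialUpperTail
  rw [Finset.sum_eq_zero, zero_div]
  intro j hj
  have : (j : ℝ) ≤ m := by exact_mod_cast Nat.lt_succ_iff.mp (Finset.mem_range.mp hj)
  rw [if_neg (by linarith)]

theorem le_rkSmall (N k s r : ℕ) (hk : 1 ≤ k) (hkm : k ≤ N / 3) (hs : 0 < s) (hN : 2 ≤ N)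
    (hr : ((k : ℝ) ^ 2 * Real.log N) / (((N / 3 + 1).choose (k - 1) : ℝ) * (s : ℝ) ^ k) ≤
      binomialUpperTail (N / 3) ((((N / 3 : ℕ) : ℝ) + (r : ℝ)) / 2)) :
    r ≤ rkSmall N k s := by
  refine le_csSup ⟨N / 3, fun t ht => ?_⟩ hr
  by_contra! hlt
  have hlt' : ((N / 3 : ℕ) : ℝ) < t := by exact_mod_cast hlt
  rw [Set.mem_ofPred_eq, binomialUpperTail_eq_zero _ _ (by linarith)] at ht
  have hlog : 0 < Real.log N := Real.log_pos (by exact_mod_cast hN)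
  have hch : 0 < (N / 3 + 1).choose (k - 1) := Nat.choose_pos (by omega)
  have : 0 < ((k : ℝ) ^ 2 * Real.log N) / (((N / 3 + 1).choose (k - 1) : ℝ) * (s : ℝ) ^ k) := by
    positivity
  linarith

theorem le_choose_succ (n j : ℕ) : n + j + 2 ≤ (n + j + 2).choose (j + 1) := by
  induction j with
  | zero => simp
  | succ j ih =>
    have e : (n + (j + 1) + 2).choose (j + 1 + 1) =
        (n + j + 2).choose (j + 1) + (n + j + 2).choose (j + 2) := Nat.choose_succ_succ _ _
    have hp : 0 < (n + j + 2).choose (j + 2) := Nat.choose_pos (by omega)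
    omega

/-- Let `m = ⌊N/3⌋` and `𝒮` finite with `1 ≤ log₂|𝒮| ≤ m^(1/4)`. For every sufficiently
large `N` and every `k` with `2 ≤ k ≤ log m`,
`r_k(m,𝒮) ≥ 0.99·√(2m(log C(m+1,k-1) + k log|𝒮|))`. -/
theorem rk_lower_bound_small_k :
    ∃ N₀ : ℕ, ∀ N : ℕ, N₀ ≤ N → ∀ (S : Type) [Fintype S],
      1 ≤ Real.logb 2 (Fintype.card S) →
      Real.logb 2 (Fintype.card S) ≤ ((N / 3 : ℕ) : ℝ) ^ ((1 : ℝ) / 4) →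
      ∀ k : ℕ, 2 ≤ k → (k : ℝ) ≤ Real.log ((N / 3 : ℕ) : ℝ) →
        0.99 * Real.sqrt (2 * ((N / 3 : ℕ) : ℝ) *
            (Real.log ((N / 3 + 1).choose (k - 1) : ℝ) +
              k * Real.log (Fintype.card S))) ≤
          (rkSmall N k (Fintype.card S) : ℝ) := by
  obtain ⟨M, hM⟩ := Filter.eventually_atTop.mp eventually_growth_conditions
  refine ⟨3 * M + 3, fun N hN S _ hs1 hs2 k hk2 hkm => ?_⟩
  obtain ⟨g1, g2, g3, g4⟩ := hM (N / 3) (by omega)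
  set m := N / 3 with hm
  set s := Fintype.card S
  have hm0 : (0 : ℝ) < m := by linarith
  have hs0 : 0 < s := by
    rcases Nat.eq_zero_or_pos s with h | h
    · rw [h] at hs1
      norm_num at hs1
    · exact h
  have hsR : (0 : ℝ) < s := by exact_mod_cast hs0
  have hk0 : (0 : ℝ) ≤ k := by positivity
  have hlog2 : 0 < Real.log 2 := Real.log_pos (by norm_num)
  have hlog2' : Real.log 2 ≤ 1 := by linarith [Real.log_two_lt_d9]
  have hlogs : Real.log s = Real.logb 2 s * Real.log 2 := by
    rw [Real.logb, div_mul_cancel₀ _ hlog2.ne']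
  have hlogs0 : 0 ≤ Real.log s := by
    rw [hlogs]
    exact mul_nonneg (by linarith) hlog2.le
  have hlogs1 : Real.log s ≤ (m : ℝ) ^ ((1 : ℝ) / 4) := by
    rw [hlogs]
    exact (mul_le_of_le_one_right (by linarith) hlog2').trans hs2
  have hkm' : k ≤ m := by
    have : (k : ℝ) ≤ m := hkm.trans (Real.log_le_self hm0.le)
    exact_mod_cast this
  have hch : 0 < (m + 1).choose (k - 1) := Nat.choose_pos (by omega)
  have hchR : (0 : ℝ) < (m + 1).choose (k - 1) := by exact_mod_cast hch
  have hch_ge : m + 1 ≤ (m + 1).choose (k - 1) := by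
    have h := le_choose_succ (m + 1 - k) (k - 2)
    rwa [show m + 1 - k + (k - 2) + 2 = m + 1 by omega, show k - 2 + 1 = k - 1 by omega] at h
  have hch_le : Real.log ((m + 1).choose (k - 1)) ≤ Real.log m * Real.log (m + 1) := by
    calc Real.log ((m + 1).choose (k - 1)) ≤ Real.log (((m : ℝ) + 1) ^ (k - 1)) := by
          apply Real.log_le_log hchR
          exact_mod_cast Nat.choose_le_pow (m + 1) (k - 1)
      _ = ((k - 1 : ℕ) : ℝ) * Real.log (m + 1) := Real.log_pow _ _
      _ ≤ _ := by
          have h0 : 0 ≤ Real.log ((m : ℝ) + 1) := Real.log_nonneg (by linarith)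
          have h1 : ((k - 1 : ℕ) : ℝ) ≤ Real.log m :=
            le_trans (by exact_mod_cast Nat.sub_le k 1) hkm
          gcongr
  set L := Real.log ((m + 1).choose (k - 1)) + k * Real.log s with hLdef
  have hL1 : Real.log m ≤ L := by
    have h1 : Real.log m ≤ Real.log ((m + 1).choose (k - 1)) := by
      apply Real.log_le_log hm0
      exact_mod_cast (Nat.le_succ m).trans hch_ge
    have := mul_nonneg hk0 hlogs0
    linarith
  have hL2 : L ≤ m / 10 ^ 8 := by
    refine le_trans (add_le_add hch_le ?_) g2
    exact mul_le_mul hkm hlogs1 hlogs0 (by linarith)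
  have hexpL : ((m + 1).choose (k - 1) : ℝ) * (s : ℝ) ^ k = Real.exp L := by
    rw [hLdef, Real.exp_add, Real.exp_log hchR, mul_comm (k : ℝ), Real.exp_mul,
      Real.exp_log hsR, Real.rpow_natCast]
  have hlogN : Real.log N ≤ Real.log (3 * m + 3) := by
    apply Real.log_le_log (by exact_mod_cast (show 0 < N by omega))
    exact_mod_cast (show N ≤ 3 * m + 3 by omega)
  have hpoly : (k : ℝ) ^ 2 * Real.log N ≤ 1 / 2 * Real.exp (0.01 * L) := by
    have h1 : (m : ℝ) ^ (0.01 : ℝ) ≤ Real.exp (0.01 * L) := by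
      rw [Real.rpow_def_of_pos hm0]
      apply Real.exp_le_exp.mpr
      linarith
    have h2 : (k : ℝ) ^ 2 * Real.log N ≤ Real.log m ^ 2 * Real.log (3 * m + 3) := by
      gcongr
    linarith
  refine (Nat.le_ceil _).trans ?_
  rw [Nat.cast_le]
  apply le_rkSmall N k s _ (by omega) hkm' hs0 (by omega)
  refine le_trans ?_ (half_exp_le_binomialUpperTail_ceil m L g4 (g3.trans hL1) hL2)
  rw [hexpL, div_le_iff₀ (Real.exp_pos _), mul_assoc, ← Real.exp_add]
  refine hpoly.trans_eq ?_
  congr 2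
  ring
end

section
/- Let A₁, A₂, …, A_M be events in a probability space, each with probability at least p > 0. Let ε ≥ 0 be given, and suppose that P(A_i ∩ A_j) ≤ p²·(1+ε) for all i ≠ j. Then P(A₁ ∪ A₂ ∪ … ∪ A_M) ≥ 1 - ε - 2/(M·p). -/
open MeasureTheory
open scoped ProbabilityTheory

/-- A Bonferroni-type bound, integrating the pointwise inequality `2tX - t²X² ≤ 1` on `X ≠ 0`,
where `X` counts the sets containing a point. -/
lemma two_mul_sum_sub_sq_mul_sum_inter_le_measureReal_iUnion {Ω ι : Type*} [MeasurableSpace Ω]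
    [Fintype ι] (μ : Measure Ω) [IsFiniteMeasure μ] (A : ι → Set Ω)
    (hA : ∀ i, MeasurableSet (A i)) (t : ℝ) :
    2 * t * ∑ i, μ.real (A i) - t ^ 2 * ∑ i, ∑ j, μ.real (A i ∩ A j) ≤ μ.real (⋃ i, A i) := by
  have hU : MeasurableSet (⋃ i, A i) := .iUnion hA
  have hint {s : Set Ω} (hs : MeasurableSet s) : Integrable (s.indicator (1 : Ω → ℝ)) μ :=
    (integrable_const (1 : ℝ)).indicator hs
  have hsingle : Integrable (fun ω ↦ ∑ i, (A i).indicator (1 : Ω → ℝ) ω) μ :=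
    integrable_finsetSum _ fun i _ ↦ hint (hA i)
  have hrow (i : ι) : Integrable (fun ω ↦ ∑ j, (A i ∩ A j).indicator (1 : Ω → ℝ) ω) μ :=
    integrable_finsetSum _ fun j _ ↦ hint ((hA i).inter (hA j))
  have hdouble : Integrable (fun ω ↦ ∑ i, ∑ j, (A i ∩ A j).indicator (1 : Ω → ℝ) ω) μ :=
    integrable_finsetSum _ fun i _ ↦ hrow i
  calc
    _ = ∫ ω, (2 * t * ∑ i, (A i).indicator (1 : Ω → ℝ) ω
          - t ^ 2 * ∑ i, ∑ j, (A i ∩ A j).indicator (1 : Ω → ℝ) ω) ∂μ := by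
      rw [integral_sub (hsingle.const_mul _) (hdouble.const_mul _), integral_const_mul,
        integral_const_mul, integral_finsetSum _ fun i _ ↦ hint (hA i),
        integral_finsetSum _ fun i _ ↦ hrow i]
      congr 2
      · exact Finset.sum_congr rfl fun i _ ↦ (integral_indicator_one (hA i)).symm
      · refine Finset.sum_congr rfl fun i _ ↦ ?_
        rw [integral_finsetSum _ fun j _ ↦ hint ((hA i).inter (hA j))]
        exact Finset.sum_congr rfl fun j _ ↦
          (integral_indicator_one ((hA i).inter (hA j))).symm
    _ ≤ ∫ ω, (⋃ i, A i).indicator (1 : Ω → ℝ) ω ∂μ := by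
      refine integral_mono ((hsingle.const_mul _).sub (hdouble.const_mul _)) (hint hU) fun ω ↦ ?_
      simp only [Set.inter_indicator_one, Pi.mul_apply, ← Finset.sum_mul_sum]
      by_cases h : ω ∈ ⋃ i, A i
      · rw [Set.indicator_of_mem h, Pi.one_apply]
        nlinarith [sq_nonneg (t * ∑ i, (A i).indicator (1 : Ω → ℝ) ω - 1)]
      · have h0 (i : ι) : (A i).indicator (1 : Ω → ℝ) ω = 0 :=
          Set.indicator_of_notMem (fun hi ↦ h (Set.mem_iUnion_of_mem i hi)) _
        simp [h0, Set.indicator_of_notMem h]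
    _ = _ := integral_indicator_one hU

/-- Let `A₁,…,A_M` be events in a probability space, each with probability at least
`p > 0`, let `ε ≥ 0`, and suppose `P(Aᵢ ∩ Aⱼ) ≤ p²(1+ε)` for all `i ≠ j`. Then
`P(A₁ ∪ … ∪ A_M) ≥ 1 - ε - 2/(Mp)`. -/
theorem union_lower_bound_pairwise {Ω : Type*} [MeasureSpace Ω]
    [IsProbabilityMeasure (ℙ : Measure Ω)]
    (M : ℕ) (hM : 1 ≤ M) (A : Fin M → Set Ω) (hmeas : ∀ i, MeasurableSet (A i))
    (p : ℝ) (hp : 0 < p) (hub : ∀ i, p ≤ (ℙ (A i)).toReal)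
    (ε : ℝ) (hε : 0 ≤ ε)
    (hpair : ∀ i j, i ≠ j → (ℙ (A i ∩ A j)).toReal ≤ p ^ 2 * (1 + ε)) :
    1 - ε - 2 / (M * p) ≤ (ℙ (⋃ i, A i)).toReal := by
  have hM0 : (0 : ℝ) < M := by exact_mod_cast hM
  set t : ℝ := 1 / (M * p) with ht
  have ht0 : 0 < t := by positivity
  have htMp : t * (M * p) = 1 := one_div_mul_cancel (by positivity)
  have h2t : 2 / (M * p) = 2 * t := by rw [ht]; ring
  rw [h2t]
  rcases le_or_gt t 2 with ht2 | ht2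
  swap
  · have : 0 ≤ (ℙ (⋃ i, A i)).toReal := ENNReal.toReal_nonneg
    linarith
  have hbound := two_mul_sum_sub_sq_mul_sum_inter_le_measureReal_iUnion ℙ A hmeas t
  simp only [measureReal_def] at hbound
  set S := ∑ i, (ℙ (A i)).toReal with hS
  have hSlow : M * p ≤ S := by
    simpa using Finset.card_nsmul_le_sum Finset.univ (fun i ↦ (ℙ (A i)).toReal) p fun i _ ↦ hub i
  have hdouble : ∑ i, ∑ j, (ℙ (A i ∩ A j)).toReal ≤ S + (M * p) ^ 2 * (1 + ε) := by
    calc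
      _ ≤ ∑ i, ∑ j, ((if i = j then (ℙ (A i)).toReal else 0) + p ^ 2 * (1 + ε)) := by
        refine Finset.sum_le_sum fun i _ ↦ Finset.sum_le_sum fun j _ ↦ ?_
        split_ifs with hij
        · subst hij
          rw [Set.inter_self]
          have : 0 ≤ p ^ 2 * (1 + ε) := by positivity
          linarith
        · simpa using hpair i j hij
      _ = _ := by
        simp [Finset.sum_add_distrib, hS]
        ring
  have hsq : t ^ 2 * (S + (M * p) ^ 2 * (1 + ε)) = t ^ 2 * S + (1 + ε) := by
    linear_combination (1 + ε) * (t * (M * p) + 1) * htMp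
  have hlin : t * (2 - t) * (M * p) ≤ t * (2 - t) * S :=
    mul_le_mul_of_nonneg_left hSlow (mul_nonneg ht0.le (by linarith))
  have hlin' : t * (2 - t) * (M * p) = 2 - t := by linear_combination (2 - t) * htMp
  nlinarith [mul_le_mul_of_nonneg_left hdouble (sq_nonneg t)]
end
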